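/- Let A, B > 1 and let (f_k) be a sequence of maps from ℝ to F, each positive and (A,B)-quasisymmetric on ℝ. Suppose there are real numbers y < z and points α, β ∈ F with f_k(y) → α, f_k(z) → β and q(β − α) > 0. Then there exist a strictly increasing function φ : ℕ → ℕ and a map f : ℝ → F which is positive and (A,B)-quasisymmetric on the interval [y, z], such that f_{φ(k)} converges to f uniformly on [y, z]. -/

import Mathlib

/-- The Minkowski quadratic form `q(v) = v₁² − ‖v′‖²` on `F = ℝ × ℝⁿ`. -/
noncomputable def Mq (n : ℕ) (v : ℝ × EuclideanSpace ℝ (Fin n)) : ℝ :=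
  v.1 ^ 2 - ‖v.2‖ ^ 2

/-- The open future cone `C = {v | ‖v′‖ < v₁}`. -/
def MC (n : ℕ) : Set (ℝ × EuclideanSpace ℝ (Fin n)) := {v | ‖v.2‖ < v.1}

/-- `f` is positive on `Ω`. -/
def MPos (n : ℕ) (f : ℝ → ℝ × EuclideanSpace ℝ (Fin n)) (Ω : Set ℝ) : Prop :=
  ∀ x ∈ Ω, ∀ y ∈ Ω, x < y → f y - f x ∈ MC n

/-- `f` is `(A,B)`-quasisymmetric on `Ω`. -/
noncomputable def MQS (n : ℕ) (A B : ℝ) (f : ℝ → ℝ × EuclideanSpace ℝ (Fin n))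
    (Ω : Set ℝ) : Prop :=
  MPos n f Ω ∧
  ∀ x ∈ Ω, ∀ y ∈ Ω, ∀ z ∈ Ω, x ≠ y → y ≠ z → x ≠ z →
    (A⁻¹ ≤ |x - y| / |z - x| ∧ |x - y| / |z - x| ≤ A) →
    (B⁻¹ ≤ Mq n (f x - f y) / Mq n (f z - f x) ∧
      Mq n (f x - f y) / Mq n (f z - f x) ≤ B)

/-- `q` is invariant under `v ↦ -v`. -/
theorem Mq_sub_comm (n : ℕ) (u v : ℝ × EuclideanSpace ℝ (Fin n)) :
    Mq n (u - v) = Mq n (v - u) := by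
  simp only [Mq, Prod.fst_sub, Prod.snd_sub, norm_sub_rev u.2 v.2]
  ring

theorem continuous_Mq (n : ℕ) : Continuous (Mq n) := by
  unfold Mq
  fun_prop

theorem Mq_pos_of_mem_MC {n : ℕ} {v : ℝ × EuclideanSpace ℝ (Fin n)} (hv : v ∈ MC n) :
    0 < Mq n v := by
  have h : ‖v.2‖ < v.1 := hv
  have := norm_nonneg v.2
  unfold Mq
  nlinarith

/-- Adding `v ∈ C` to `b ∈ C` multiplies `q` at least by `1 + v₁ / b₁`. -/
theorem Mq_add_ge {n : ℕ} {v b : ℝ × EuclideanSpace ℝ (Fin n)} (hv : v ∈ MC n)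
    (hb : b ∈ MC n) : (b.1 + v.1) * Mq n b ≤ b.1 * Mq n (v + b) := by
  have hv' : ‖v.2‖ < v.1 := hv
  have hb' : ‖b.2‖ < b.1 := hb
  have h0 := norm_nonneg v.2
  have h1 := norm_nonneg b.2
  have h2 : ‖v.2 + b.2‖ ^ 2 ≤ (‖v.2‖ + ‖b.2‖) ^ 2 :=
    pow_le_pow_left₀ (norm_nonneg _) (norm_add_le _ _) 2
  have h3 : (v.1 + b.1) ^ 2 - (‖v.2‖ + ‖b.2‖) ^ 2 ≤ Mq n (v + b) := by
    simp only [Mq, Prod.fst_add, Prod.snd_add]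
    linarith
  refine le_trans ?_ (mul_le_mul_of_nonneg_left h3 (h1.trans hb'.le))
  unfold Mq
  have h4 : 0 ≤ b.1 * ((v.1 - ‖v.2‖) * (v.1 + ‖v.2‖)) := by
    apply mul_nonneg (by linarith)
    exact mul_nonneg (by linarith) (by linarith)
  have h5 : 0 ≤ v.1 * (b.1 - ‖b.2‖) ^ 2 := mul_nonneg (by linarith) (sq_nonneg _)
  have h6 : 0 ≤ b.1 * ‖b.2‖ * (v.1 - ‖v.2‖) :=
    mul_nonneg (mul_nonneg (by linarith) h1) (by linarith)
  linarith

section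

variable {n : ℕ} {A B : ℝ} {f : ℝ → ℝ × EuclideanSpace ℝ (Fin n)}

theorem MPos.Mq_pos (hf : MPos n f Set.univ) {x y : ℝ} (h : x ≠ y) :
    0 < Mq n (f x - f y) := by
  rcases lt_or_gt_of_ne h with h | h
  · rw [Mq_sub_comm]
    exact Mq_pos_of_mem_MC (hf _ trivial _ trivial h)
  · exact Mq_pos_of_mem_MC (hf _ trivial _ trivial h)

/-- Two increments of comparable length from the same base point have comparable `q`. -/
theorem MQS.Mq_le_pow (hA : 1 < A) (hB : 1 < B) (hf : MQS n A B f Set.univ) (p : ℝ) (m : ℕ) :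
    ∀ s t : ℝ, s ≠ 0 → t ≠ 0 → |t| ≤ A ^ m * |s| → |s| ≤ A ^ m * |t| →
      Mq n (f (p + s) - f p) ≤ B ^ (m + 1) * Mq n (f (p + t) - f p) := by
  have hA0 : 0 < A := by linarith
  have step : ∀ s t : ℝ, s ≠ 0 → t ≠ 0 → |t| ≤ A * |s| → |s| ≤ A * |t| →
      Mq n (f (p + s) - f p) ≤ B * Mq n (f (p + t) - f p) := by
    intro s t hs ht h1 h2
    have hqt : 0 < Mq n (f (p + t) - f p) := hf.1.Mq_pos (by simpa using ht)
    by_cases hst : s = t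
    · subst hst
      nlinarith
    · have hs' := abs_pos.2 hs
      have ht' := abs_pos.2 ht
      have key := (hf.2 p trivial (p + s) trivial (p + t) trivial (by simpa using hs)
        (by simpa using hst) (by simpa using ht) ?_).2
      · rwa [div_le_iff₀ hqt, Mq_sub_comm] at key
      · simp only [sub_add_cancel_left, abs_neg, add_sub_cancel_left]
        rw [div_le_iff₀ ht', le_div_iff₀ ht', inv_mul_le_iff₀ hA0]
        exact ⟨h1, h2⟩
  induction m with
  | zero =>
    intro s t hs ht h1 h2
    simp only [pow_zero, one_mul] at h1 h2
    simpa using step s t hs ht (by nlinarith [abs_nonneg s]) (by nlinarith [abs_nonneg t])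
  | succ m ih =>
    intro s t hs ht h1 h2
    have hs' := abs_pos.2 hs
    have ht' := abs_pos.2 ht
    have hAm : 1 ≤ A ^ m := one_le_pow₀ hA.le
    have combine : ∀ u : ℝ, u ≠ 0 → |u| ≤ A * |s| → |s| ≤ A * |u| →
        |t| ≤ A ^ m * |u| → |u| ≤ A ^ m * |t| →
        Mq n (f (p + s) - f p) ≤ B ^ (m + 1 + 1) * Mq n (f (p + t) - f p) := by
      intro u hu k1 k2 k3 k4
      calc _ ≤ B * Mq n (f (p + u) - f p) := step s u hs hu k1 k2
        _ ≤ B * (B ^ (m + 1) * Mq n (f (p + t) - f p)) := by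
          gcongr
          exact ih u t hu ht k3 k4
        _ = _ := by ring
    rw [pow_succ] at h1 h2
    rcases lt_or_ge (A * |s|) |t| with h | h
    · have e : |A * s| = A * |s| := by rw [abs_mul, abs_of_pos hA0]
      have hu : 0 ≤ |A * s| := abs_nonneg _
      refine combine (A * s) (mul_ne_zero hA0.ne' hs) e.le ?_ ?_ ?_
      · exact (le_mul_of_one_le_left hs'.le hA.le).trans (e ▸ le_mul_of_one_le_left hu hA.le)
      · rwa [e, ← mul_assoc]
      · rw [e]
        exact h.le.trans (le_mul_of_one_le_left ht'.le hAm)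
    rcases lt_or_ge (A * |t|) |s| with h' | h'
    · have e : |s / A| = |s| / A := by rw [abs_div, abs_of_pos hA0]
      have e' : A * |s / A| = |s| := by
        rw [e]
        field_simp
      have hu : 0 ≤ |s / A| := abs_nonneg _
      have hus : |s / A| ≤ |s| := e' ▸ le_mul_of_one_le_left hu hA.le
      refine combine (s / A) (div_ne_zero hs hA0.ne') ?_ e'.ge ?_ ?_
      · exact hus.trans (le_mul_of_one_le_left hs'.le hA.le)
      · have : |t| ≤ |s / A| := by
          rw [e, le_div_iff₀ hA0, mul_comm]
          exact h'.le
        exact this.trans (le_mul_of_one_le_left hu hAm)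
      · rw [e, div_le_iff₀ hA0]
        linarith
    · exact combine t ht h h' (le_mul_of_one_le_left ht'.le hAm)
        (le_mul_of_one_le_left ht'.le hAm)

/-- The time coordinate increases by at most a fixed proportion over either half of an interval. -/
theorem MQS.exists_half_increment (hA : 1 < A) (hB : 1 < B) :
    ∃ θ : ℝ, 0 ≤ θ ∧ θ < 1 ∧ ∀ f : ℝ → ℝ × EuclideanSpace ℝ (Fin n), MQS n A B f Set.univ →
      ∀ p h : ℝ, 0 < h → (f p).1 - (f (p - h)).1 ≤ θ * ((f (p + h)).1 - (f (p - h)).1) ∧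
        (f (p + h)).1 - (f p).1 ≤ θ * ((f (p + h)).1 - (f (p - h)).1) := by
  obtain ⟨m, hm⟩ := pow_unbounded_of_one_lt 2 hA
  set M := B ^ (m + 1) with hM
  have hM1 : 1 < M := one_lt_pow₀ hB (by omega)
  refine ⟨1 - M⁻¹, by linarith [inv_le_one_of_one_le₀ hM1.le], by
    linarith [inv_pos.2 (zero_lt_one.trans hM1)], ?_⟩
  intro f hf p h hh
  have hb : f (p + h) - f p ∈ MC n := hf.1 _ trivial _ trivial (by linarith)
  have hv : f p - f (p - h) ∈ MC n := hf.1 _ trivial _ trivial (by linarith)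
  have pos1 : ∀ {u : ℝ × EuclideanSpace ℝ (Fin n)}, u ∈ MC n → 0 < u.1 :=
    fun {u} hu => (norm_nonneg u.2).trans_lt hu
  have key : ∀ v b : ℝ × EuclideanSpace ℝ (Fin n), v ∈ MC n → b ∈ MC n →
      Mq n (v + b) ≤ M * Mq n b → M⁻¹ * (v.1 + b.1) ≤ b.1 := by
    intro v b hv hb hq
    rw [inv_mul_le_iff₀ (by linarith)]
    have h1 := Mq_add_ge hv hb
    have h2 := mul_le_mul_of_nonneg_left hq (pos1 hb).le
    have h3 := Mq_pos_of_mem_MC hb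
    by_contra! hc
    nlinarith
  have a1 : |h| = h := abs_of_pos hh
  have a2 : |-h| = h := by rw [abs_neg, a1]
  have a3 : |2 * h| = 2 * h := abs_of_pos (by linarith)
  have a4 : |-(2 * h)| = 2 * h := by rw [abs_neg, a3]
  have q1 := hf.Mq_le_pow hA hB (p + h) m (-(2 * h)) (-h) (by linarith) (by linarith)
    (by rw [a4, a2]; nlinarith) (by rw [a4, a2]; nlinarith)
  have q2 := hf.Mq_le_pow hA hB (p - h) m (2 * h) h (by linarith) (by linarith)
    (by rw [a3, a1]; nlinarith) (by rw [a3, a1]; nlinarith)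
  rw [show p + h + -(2 * h) = p - h by ring, show p + h + -h = p by ring, Mq_sub_comm,
    Mq_sub_comm n (f p)] at q1
  rw [show p - h + 2 * h = p + h by ring, show p - h + h = p by ring] at q2
  have k1 := key _ _ hv hb (by rwa [show f p - f (p - h) + (f (p + h) - f p)
    = f (p + h) - f (p - h) by abel])
  have k2 := key _ _ hb hv (by rwa [show f (p + h) - f p + (f p - f (p - h))
    = f (p + h) - f (p - h) by abel])
  simp only [Prod.fst_sub] at k1 k2
  constructor <;> linarith

theorem MPos.fst_mono (hf : MPos n f Set.univ) {x y : ℝ} (h : x ≤ y) : (f x).1 ≤ (f y).1 := by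
  rcases h.eq_or_lt with rfl | h
  · rfl
  · have h1 : ‖(f y - f x).2‖ < (f y - f x).1 := hf _ trivial _ trivial h
    have := (norm_nonneg _).trans_lt h1
    simp only [Prod.fst_sub] at this
    linarith

theorem MPos.dist_le (hf : MPos n f Set.univ) {x y : ℝ} (h : x ≤ y) :
    dist (f x) (f y) ≤ (f y).1 - (f x).1 := by
  rcases h.eq_or_lt with rfl | h
  · simp
  · have h1 : ‖(f y - f x).2‖ < (f y - f x).1 := hf _ trivial _ trivial h
    rw [dist_comm, dist_eq_norm, Prod.norm_def]
    refine max_le ?_ h1.le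
    rw [Real.norm_eq_abs, abs_of_pos ((norm_nonneg _).trans_lt h1)]
    rfl

/-- Geometric decay of the increments of the time coordinate at small scales. -/
theorem fst_increment_le_pow {θ : ℝ} (hθ : 0 ≤ θ) (hf : MQS n A B f Set.univ)
    (H : ∀ p h : ℝ, 0 < h → (f p).1 - (f (p - h)).1 ≤ θ * ((f (p + h)).1 - (f (p - h)).1) ∧
        (f (p + h)).1 - (f p).1 ≤ θ * ((f (p + h)).1 - (f (p - h)).1)) {y z : ℝ} (j : ℕ) :
    ∀ x h : ℝ, 0 < h → y ≤ x → x + h ≤ z → 2 ^ (j + 1) * h ≤ z - y →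
      (f (x + h)).1 - (f x).1 ≤ θ ^ j * ((f z).1 - (f y).1) := by
  induction j with
  | zero =>
    intro x h hh hx hz _
    have := hf.1.fst_mono hx
    have := hf.1.fst_mono hz
    simp only [pow_zero, one_mul]
    linarith
  | succ j ih =>
    intro x h hh hx hz hj
    have h2 : (1 : ℝ) ≤ 2 ^ j := one_le_pow₀ one_le_two
    have hj' : 2 ^ (j + 1) * (2 * h) ≤ z - y := by
      rw [pow_succ] at hj
      linarith
    have h4 : 4 * h ≤ z - y := by
      rw [pow_succ] at hj'
      nlinarith
    rw [pow_succ', mul_assoc]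
    rcases le_total (x + 2 * h) z with hc | hc
    · have h5 := (H (x + h) h hh).1
      rw [show x + h + h = x + 2 * h by ring, add_sub_cancel_right] at h5
      exact h5.trans (mul_le_mul_of_nonneg_left (ih x (2 * h) (by linarith) hx hc hj') hθ)
    · have h5 := (H x h hh).2
      have h6 := ih (x - h) (2 * h) (by linarith) (by linarith) (by linarith) hj'
      rw [show x - h + 2 * h = x + h by ring] at h6
      exact h5.trans (mul_le_mul_of_nonneg_left h6 hθ)

/-- A pointwise limit on `[y,z]` of quasisymmetric maps with nondegenerate endpoint difference
is quasisymmetric. -/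
theorem MQS.of_tendsto (hA : 1 < A) (hB : 1 < B) {F : ℕ → ℝ → ℝ × EuclideanSpace ℝ (Fin n)}
    (hF : ∀ k, MQS n A B (F k) Set.univ) {y z : ℝ} (hyz : y < z)
    (hlim : ∀ x ∈ Set.Icc y z, Filter.Tendsto (fun k => F k x) Filter.atTop (nhds (f x)))
    (hq : 0 < Mq n (f z - f y)) : MQS n A B f (Set.Icc y z) := by
  have hqlim : ∀ a ∈ Set.Icc y z, ∀ b ∈ Set.Icc y z,
      Filter.Tendsto (fun k => Mq n (F k a - F k b)) Filter.atTop (nhds (Mq n (f a - f b))) :=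
    fun a ha b hb => ((continuous_Mq n).tendsto _).comp ((hlim a ha).sub (hlim b hb))
  have chain : ∀ p s t : ℝ, s ≠ 0 → t ≠ 0 → ∃ K : ℝ, 0 < K ∧
      ∀ k, Mq n (F k (p + s) - F k p) ≤ K * Mq n (F k (p + t) - F k p) := by
    intro p s t hs ht
    have hs' := abs_pos.2 hs
    have ht' := abs_pos.2 ht
    obtain ⟨m, hm⟩ := pow_unbounded_of_one_lt (max (|t| / |s|) (|s| / |t|)) hA
    obtain ⟨hm1, hm2⟩ := max_lt_iff.1 hm
    rw [div_lt_iff₀ hs'] at hm1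
    rw [div_lt_iff₀ ht'] at hm2
    exact ⟨B ^ (m + 1), by positivity,
      fun k => (hF k).Mq_le_pow hA hB p m s t hs ht hm1.le hm2.le⟩
  have hyI : y ∈ Set.Icc y z := Set.left_mem_Icc.2 hyz.le
  have hzI : z ∈ Set.Icc y z := Set.right_mem_Icc.2 hyz.le
  have hpos : ∀ a ∈ Set.Icc y z, ∀ b ∈ Set.Icc y z, a < b → 0 < Mq n (f b - f a) := by
    intro a ha b hb hab
    have hyb : y < b := ha.1.trans_lt hab
    obtain ⟨K₁, hK₁, h₁⟩ := chain y (z - y) (b - y) (by linarith) (by linarith)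
    obtain ⟨K₂, hK₂, h₂⟩ := chain b (y - b) (a - b) (by linarith) (by linarith)
    have h : ∀ k, Mq n (F k z - F k y) ≤ K₁ * (K₂ * Mq n (F k b - F k a)) := by
      intro k
      have e₁ := h₁ k
      have e₂ := h₂ k
      simp only [add_sub_cancel] at e₁ e₂
      rw [Mq_sub_comm, Mq_sub_comm n (F k a)] at e₂
      exact e₁.trans (mul_le_mul_of_nonneg_left e₂ hK₁.le)
    have h' := le_of_tendsto_of_tendsto' (hqlim z hzI y hyI)
      (((hqlim b hb a ha).const_mul K₂).const_mul K₁) h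
    have h'' := hq.trans_le h'
    exact (pos_iff_pos_of_mul_pos ((pos_iff_pos_of_mul_pos h'').1 hK₁)).1 hK₂
  refine ⟨fun a ha b hb hab => ?_, fun u hu v hv w hw huv hvw huw hr => ?_⟩
  · have hd := (hlim b hb).sub (hlim a ha)
    have h1 : ‖(f b - f a).2‖ ≤ (f b - f a).1 :=
      le_of_tendsto_of_tendsto' ((continuous_snd.norm.tendsto _).comp hd)
        ((continuous_fst.tendsto _).comp hd)
        fun k => le_of_lt ((hF k).1 a trivial b trivial hab)
    have h2 := hpos a ha b hb hab
    refine lt_of_le_of_ne h1 fun h => ?_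
    simp only [Mq, h, sub_self, lt_self_iff_false] at h2
  · have hne : Mq n (f w - f u) ≠ 0 := by
      rcases lt_or_gt_of_ne huw with h | h
      · exact (hpos u hu w hw h).ne'
      · rw [Mq_sub_comm]
        exact (hpos w hw u hu h).ne'
    have ht := (hqlim u hu v hv).div (hqlim w hw u hu) hne
    have hk := fun k => (hF k).2 u trivial v trivial w trivial huv hvw huw hr
    exact ⟨ge_of_tendsto' ht fun k => (hk k).1, le_of_tendsto' ht fun k => (hk k).2⟩

end

/-- Given a sequence of `(A,B)`-quasisymmetric maps `f_k : ℝ → F` with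
`f_k(y) → α`, `f_k(z) → β` and `q(β − α) > 0` for some `y < z`, some subsequence
converges uniformly on `[y,z]` to a positive `(A,B)`-quasisymmetric map. -/
theorem stmt_13 (n : ℕ) (A B : ℝ) (hA : 1 < A) (hB : 1 < B)
    (f : ℕ → ℝ → ℝ × EuclideanSpace ℝ (Fin n))
    (hf : ∀ k, MQS n A B (f k) Set.univ)
    (y z : ℝ) (hyz : y < z) (α β : ℝ × EuclideanSpace ℝ (Fin n))
    (hα : Filter.Tendsto (fun k => f k y) Filter.atTop (nhds α))
    (hβ : Filter.Tendsto (fun k => f k z) Filter.atTop (nhds β))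
    (hq : 0 < Mq n (β - α)) :
    ∃ φ : ℕ → ℕ, StrictMono φ ∧
      ∃ g : ℝ → ℝ × EuclideanSpace ℝ (Fin n),
        MQS n A B g (Set.Icc y z) ∧
        TendstoUniformlyOn (fun k => f (φ k)) g Filter.atTop (Set.Icc y z) := by
  obtain ⟨θ, hθ0, hθ1, H⟩ := MQS.exists_half_increment (n := n) hA hB
  have hL : 0 < z - y := by linarith
  obtain ⟨R, hR⟩ : ∃ R : ℝ, ∀ k, dist (f k z) (f k y) ≤ R := by
    obtain ⟨R, hR⟩ := (hβ.dist hα).bddAbove_range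
    exact ⟨R, fun k => hR ⟨k, rfl⟩⟩
  obtain ⟨S, hS⟩ : ∃ S : ℝ, ∀ k, dist (f k y) α ≤ S := by
    obtain ⟨S, hS⟩ := (hα.dist (tendsto_const_nhds (x := α))).bddAbove_range
    exact ⟨S, fun k => hS ⟨k, rfl⟩⟩
  have hfst : ∀ k, (f k z).1 - (f k y).1 ≤ R := by
    intro k
    have h := hR k
    rw [Prod.dist_eq] at h
    exact (le_abs_self _).trans ((le_max_left _ _).trans h)
  have hequi : ∀ ε > 0, ∃ δ > 0, ∀ a b : ℝ, y ≤ a → a ≤ b → b ≤ z → b - a < δ →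
      ∀ k, dist (f k a) (f k b) < ε := by
    intro ε hε
    have ht : Filter.Tendsto (fun j : ℕ => θ ^ j * R) Filter.atTop (nhds (0 * R)) :=
      (tendsto_pow_atTop_nhds_zero_of_lt_one hθ0 hθ1).mul_const R
    rw [zero_mul] at ht
    obtain ⟨j, hj⟩ := (ht.eventually (gt_mem_nhds hε)).exists
    refine ⟨(z - y) / 2 ^ (j + 1), by positivity, fun a b ha hab hb hd k => ?_⟩
    rcases hab.eq_or_lt with rfl | hab'
    · simpa using hε
    rw [lt_div_iff₀ (by positivity)] at hd
    have h := fst_increment_le_pow hθ0 (hf k) (H _ (hf k)) (y := y) (z := z) j a (b - a)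
      (by linarith) ha (by linarith) (by linarith)
    rw [add_sub_cancel] at h
    calc dist (f k a) (f k b) ≤ _ := (hf k).1.dist_le hab
      _ ≤ _ := h
      _ ≤ θ ^ j * R := mul_le_mul_of_nonneg_left (hfst k) (pow_nonneg hθ0 j)
      _ < ε := hj
  have hunif : ∀ ε > 0, ∃ δ > 0, ∀ a b : Set.Icc y z, dist a b < δ →
      ∀ k, dist (f k a) (f k b) < ε := by
    intro ε hε
    obtain ⟨δ, hδ, h⟩ := hequi ε hε
    refine ⟨δ, hδ, fun a b hab k => ?_⟩
    rw [Subtype.dist_eq, Real.dist_eq, abs_lt] at hab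
    rcases le_total (a : ℝ) b with hle | hle
    · exact h a b a.2.1 hle b.2.2 (by linarith) k
    · rw [dist_comm]
      exact h b a b.2.1 hle a.2.2 (by linarith) k
  have hcont : ∀ k, Continuous fun x : Set.Icc y z => f k x := by
    intro k
    rw [Metric.continuous_iff]
    intro b ε hε
    obtain ⟨δ, hδ, h⟩ := hunif ε hε
    exact ⟨δ, hδ, fun a hab => h a b hab k⟩
  let G : ℕ → BoundedContinuousFunction (Set.Icc y z) (ℝ × EuclideanSpace ℝ (Fin n)) :=
    fun k => BoundedContinuousFunction.mkOfCompact ⟨fun x => f k x, hcont k⟩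
  have hcpt : IsCompact (closure (Set.range G)) := by
    refine BoundedContinuousFunction.arzela_ascoli (Metric.closedBall α (R + S))
      (isCompact_closedBall _ _) _ ?_ ?_
    · rintro _ x ⟨k, rfl⟩
      rw [Metric.mem_closedBall]
      have h1 : dist (f k x) (f k y) ≤ R := by
        rw [dist_comm]
        have := (hf k).1.dist_le x.2.1
        have := (hf k).1.fst_mono x.2.2
        linarith [hfst k]
      exact (dist_triangle _ (f k y) _).trans (add_le_add h1 (hS k))
    · refine UniformEquicontinuous.equicontinuous ?_
      rw [Metric.uniformEquicontinuous_iff]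
      intro ε hε
      obtain ⟨δ, hδ, h⟩ := hunif ε hε
      refine ⟨δ, hδ, ?_⟩
      rintro a b hab ⟨_, k, rfl⟩
      exact h a b hab k
  obtain ⟨g, -, φ, hφ, hg⟩ := hcpt.tendsto_subseq fun k => subset_closure (Set.mem_range_self k)
  rw [BoundedContinuousFunction.tendsto_iff_tendstoUniformly] at hg
  have hgu : TendstoUniformlyOn (fun k => f (φ k)) (fun x => g (Set.projIcc y z hyz.le x))
      Filter.atTop (Set.Icc y z) := by
    rw [Metric.tendstoUniformlyOn_iff]
    intro ε hε
    filter_upwards [Metric.tendstoUniformly_iff.1 hg ε hε] with k hk x hx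
    rw [Set.projIcc_of_mem hyz.le hx]
    exact hk ⟨x, hx⟩
  refine ⟨φ, hφ, _, MQS.of_tendsto hA hB (fun k => hf (φ k)) hyz
    (fun x hx => hgu.tendsto_at hx) ?_, hgu⟩
  rw [tendsto_nhds_unique (hgu.tendsto_at (Set.left_mem_Icc.2 hyz.le))
      (hα.comp hφ.tendsto_atTop),
    tendsto_nhds_unique (hgu.tendsto_at (Set.right_mem_Icc.2 hyz.le))
      (hβ.comp hφ.tendsto_atTop)]
  exact hq
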